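/- Let Ω ⊂ ℝ² be a (not necessarily bounded or regular) domain, let ρ > 0 be such that the sublevel set {d_Ω < −ρ} is non-empty, and let X ∈ H²(Ω; ℝ²) be weakly biharmonic, i.e. ∫_Ω ⟨ΔX, Δφ⟩ dx = 0 for all φ ∈ C_c^∞(Ω; ℝ²) (so that X is smooth in the interior of Ω by elliptic regularity). Then there exists an independent constant C such that ∫_{{d_Ω < −ρ}} |∇³X|² dx ≤ C ∫_Ω ( ρ^{−2} |∇²X|² + ρ^{−4} |∇X|² + ρ^{−6} |X|² ) dx. -/

import Mathlib

open MeasureTheory Metric Set Filter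
open scoped RealInnerProductSpace ENNReal Topology NNReal

noncomputable section

abbrev E2 : Type := EuclideanSpace ℝ (Fin 2)

namespace StokesPaper

/-- The `i`-th standard basis vector of `ℝ²`. -/
def e (i : Fin 2) : E2 := EuclideanSpace.single i (1 : ℝ)

/-- Rotation by +90°; produces the right-handed unit tangent `τ = (-ν₂, ν₁)`
from the outer normal `ν`. -/
def rot (v : E2) : E2 := ⟪v, e 0⟫ • e 1 - ⟪v, e 1⟫ • e 0

/-- The uniform ball condition (UBC) with radius `r`: at every boundary point there are
an open interior ball and an open exterior ball of radius `r` whose boundary spheres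
meet exactly at that point. -/
def IsUBCWith (Ω : Set E2) (r : ℝ) : Prop :=
  0 < r ∧ ∀ x ∈ frontier Ω, ∃ cIn cOut : E2,
    ball cIn r ⊆ Ω ∧ ball cOut r ⊆ Ωᶜ ∧ sphere cIn r ∩ sphere cOut r = {x}

/-- A UBC domain: a bounded domain satisfying the UBC for some radius. -/
def IsUBCDomain (Ω : Set E2) : Prop :=
  IsOpen Ω ∧ IsConnected Ω ∧ Bornology.IsBounded Ω ∧ ∃ r : ℝ, IsUBCWith Ω r

/-- The maximal UBC radius `r_Ω`. -/
def ubcRadius (Ω : Set E2) : ℝ := sSup {r : ℝ | IsUBCWith Ω r}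

/-- The perimeter `P(Ω) = H¹(∂Ω)`. -/
def perim (Ω : Set E2) : ℝ := (μH[1] (frontier Ω)).toReal

/-- The area `|Ω|`. -/
def area (Ω : Set E2) : ℝ := (volume Ω).toReal

/-- Boundary integral with respect to the 1-dimensional Hausdorff measure. -/
def bInt (Ω : Set E2) (f : E2 → ℝ) : ℝ := ∫ x in frontier Ω, f x ∂μH[1]

open Classical in
/-- The signed distance function `d_Ω` (negative inside `Ω`). -/
def sdist (Ω : Set E2) (x : E2) : ℝ :=
  if x ∈ Ω then -(infDist x (frontier Ω)) else infDist x Ω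

/-- The tubular neighborhood `N_r(∂Ω)`. -/
def tubNbhd (Ω : Set E2) (r : ℝ) : Set E2 := {x : E2 | infDist x (frontier Ω) < r}

/-- Pointwise vector Laplacian. -/
def vLap (u : E2 → E2) (x : E2) : E2 :=
  ∑ i : Fin 2, fderiv ℝ (fderiv ℝ u) x (e i) (e i)

/-- Pointwise gradient of a scalar function. -/
def gradv (f : E2 → ℝ) (x : E2) : E2 := ∑ i : Fin 2, fderiv ℝ f x (e i) • e i

/-- Pointwise divergence of a vector field. -/
def divg (u : E2 → E2) (x : E2) : ℝ := ∑ i : Fin 2, ⟪fderiv ℝ u x (e i), e i⟫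

/-- The entry `(∇u)_{ij} = ∂_j u_i` of the gradient matrix. -/
def gradEntry (u : E2 → E2) (x : E2) (i j : Fin 2) : ℝ := ⟪fderiv ℝ u x (e j), e i⟫

/-- The entry of the symmetric gradient `∇_sym u = (∇u + (∇u)ᵀ)/2`. -/
def symGradEntry (u : E2 → E2) (x : E2) (i j : Fin 2) : ℝ :=
  (gradEntry u x i j + gradEntry u x j i) / 2

/-- The symmetric gradient applied to a vector. -/
def symGradApp (u : E2 → E2) (x v : E2) : E2 :=
  ∑ i : Fin 2, (∑ j : Fin 2, symGradEntry u x i j * ⟪v, e j⟫) • e i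

/-- Squared Frobenius norm `|∇u|²`. -/
def gradNormSq (u : E2 → E2) (x : E2) : ℝ :=
  ∑ i : Fin 2, ∑ j : Fin 2, (gradEntry u x i j)^2

/-- Squared Frobenius norm `|∇_sym u|²`. -/
def symGradNormSq (u : E2 → E2) (x : E2) : ℝ :=
  ∑ i : Fin 2, ∑ j : Fin 2, (symGradEntry u x i j)^2

/-- `ν` is the outer unit normal of `Ω` at the boundary point `x`, characterized via the
interior and exterior tangent balls of the uniform ball condition. -/
def IsOuterNormalAt (Ω : Set E2) (x ν : E2) : Prop :=
  ‖ν‖ = 1 ∧ ∀ r : ℝ, IsUBCWith Ω r →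
    ball (x - r • ν) r ⊆ Ω ∧ ball (x + r • ν) r ⊆ Ωᶜ

/-- `∫_Ω |∇^k u|² dx`. -/
def derivSq (k : ℕ) (Ω : Set E2) (u : E2 → E2) : ℝ :=
  ∫ x in Ω, ‖iteratedFDeriv ℝ k u x‖^2

/-- Squared Sobolev norm `‖u‖²_{H^n(Ω)}`. -/
def hSobSq (n : ℕ) (Ω : Set E2) (u : E2 → E2) : ℝ :=
  ∑ k ∈ Finset.range (n + 1), derivSq k Ω u

/-- Scalar Laplacian. -/
def lapS (u : E2 → ℝ) (x : E2) : ℝ :=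
  ∑ i : Fin 2, fderiv ℝ (fderiv ℝ u) x (e i) (e i)

lemma conv_bound {F E' : Type} [NormedAddCommGroup F] [NormedSpace ℝ F]
    [NormedAddCommGroup E'] [NormedSpace ℝ E'] (n : ℕ)
    (f : E2 → E2) (hf : Continuous f) (L : E2 →L[ℝ] E' →L[ℝ] F) (g : E2 → E')
    (hg : ContDiff ℝ (⊤ : ℕ∞) g) (hcg : HasCompactSupport g) (x : E2) :
    ‖iteratedFDeriv ℝ n (convolution f g L volume) x‖ ≤
      ‖L‖ * ∫ t, ‖f t‖ * ‖iteratedFDeriv ℝ n g (x - t)‖ := by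
  induction n generalizing F E' with
  | zero =>
    simp only [norm_iteratedFDeriv_zero]
    rw [convolution, ← integral_const_mul]
    refine norm_integral_le_of_norm_le ?_ ?_
    · apply Integrable.const_mul
      apply Continuous.integrable_of_hasCompactSupport
      · have := hg.continuous
        fun_prop
      · apply HasCompactSupport.mul_left
        apply HasCompactSupport.norm
        exact hcg.comp_homeomorph (Homeomorph.subLeft x)
    · filter_upwards with t
      rw [← mul_assoc]
      exact L.le_opNorm₂ _ _
  | succ n ih =>
    have h1 : fderiv ℝ (convolution f g L volume) =
        convolution f (fderiv ℝ g) (L.precompR E2) volume := by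
      ext1 z
      exact (hcg.hasFDerivAt_convolution_right L hf.locallyIntegrable
        (hg.of_le (by exact_mod_cast le_top)) z).fderiv
    rw [← norm_iteratedFDeriv_fderiv, h1]
    have := ih (L.precompR E2) (fderiv ℝ g) (hg.fderiv_right (by exact_mod_cast le_top))
      (hcg.fderiv ℝ)
    simp only [norm_iteratedFDeriv_fderiv] at this
    refine this.trans ?_
    gcongr
    exact L.norm_precompR_le E2

lemma fderiv_radial {g : ℝ → ℝ} (hg : Differentiable ℝ g) (y v : E2) :
    fderiv ℝ (fun y : E2 => g (‖y‖ ^ 2)) y v = 2 * deriv g (‖y‖ ^ 2) * ⟪y, v⟫ := by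
  have h1 : HasFDerivAt (fun y : E2 => ‖y‖ ^ 2) (2 • innerSL ℝ y) y :=
    (hasStrictFDerivAt_norm_sq y).hasFDerivAt
  have h2 := ((hg (‖y‖ ^ 2)).hasDerivAt).comp_hasFDerivAt y h1
  have h3 : fderiv ℝ (fun y : E2 => g (‖y‖ ^ 2)) y = _ := h2.fderiv
  rw [h3]
  simp
  ring

lemma sum_inner_e (y : E2) : ∑ i : Fin 2, ⟪y, e i⟫ * ⟪y, e i⟫ = ‖y‖ ^ 2 := by
  rw [EuclideanSpace.norm_sq_eq]
  simp [e, EuclideanSpace.inner_single_right, Fin.sum_univ_two, pow_two]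

lemma sum_smul_e (y : E2) : ∑ i : Fin 2, ⟪y, e i⟫ • e i = y := by
  ext j
  fin_cases j <;> simp [e, EuclideanSpace.inner_single_right, Fin.sum_univ_two]

lemma inner_e_self (i : Fin 2) : ⟪e i, e i⟫ = (1 : ℝ) := by
  simp [e]

lemma lapS_radial {h : ℝ → ℝ} (hh : ContDiff ℝ (⊤ : ℕ∞) h) (y : E2) :
    lapS (fun y : E2 => h (‖y‖ ^ 2)) y =
      4 * deriv h (‖y‖ ^ 2) + 4 * ‖y‖ ^ 2 * deriv (deriv h) (‖y‖ ^ 2) := by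
  have hd : ContDiff ℝ (⊤ : ℕ∞) (deriv h) := by
    have : ContDiff ℝ ((⊤ : ℕ∞) + 1) h := hh
    exact (contDiff_succ_iff_deriv.1 this).2.2
  have hH : ContDiff ℝ (⊤ : ℕ∞) (fun y : E2 => h (‖y‖ ^ 2)) :=
    hh.comp (contDiff_norm_sq ℝ)
  have key : ∀ v : E2, fderiv ℝ (fderiv ℝ (fun y : E2 => h (‖y‖ ^ 2))) y v v =
      2 * (2 * deriv (deriv h) (‖y‖ ^ 2) * ⟪y, v⟫) * ⟪y, v⟫ +
        2 * deriv h (‖y‖ ^ 2) * ⟪v, v⟫ := by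
    intro v
    have hdiff : DifferentiableAt ℝ (fderiv ℝ (fun y : E2 => h (‖y‖ ^ 2))) y :=
      ((hH.fderiv_right (m := (⊤ : ℕ∞)) (by exact_mod_cast le_top)).differentiable (by simp)) y
    have h1 : fderiv ℝ (fderiv ℝ (fun y : E2 => h (‖y‖ ^ 2))) y v v =
        fderiv ℝ (fun z => fderiv ℝ (fun y : E2 => h (‖y‖ ^ 2)) z v) y v := by
      rw [fderiv_clm_apply hdiff (differentiableAt_const v)]
      simp
    rw [h1]
    simp_rw [fderiv_radial (hh.differentiable (by simp))]
    have hdd : DifferentiableAt ℝ (fun z : E2 => deriv h (‖z‖ ^ 2)) y :=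
      ((hd.comp (contDiff_norm_sq ℝ)).differentiable (by simp)) y
    have hin : DifferentiableAt ℝ (fun z : E2 => ⟪z, v⟫) y :=
      differentiableAt_fun_id.inner ℝ (differentiableAt_const v)
    rw [fderiv_fun_mul (hdd.const_mul 2) hin, fderiv_const_mul hdd]
    have h4 : fderiv ℝ (fun z : E2 => ⟪z, v⟫) y v = ⟪v, v⟫ := by
      rw [fderiv_inner_apply ℝ differentiableAt_fun_id (differentiableAt_const v)]
      simp
    simp [h4, fderiv_radial (hd.differentiable (by simp))]
    ring
  unfold lapS
  simp_rw [key, inner_e_self]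
  have := sum_inner_e y
  simp only [Fin.sum_univ_two] at this ⊢
  rw [← this]
  ring


lemma contDiff_deriv_top {h : ℝ → ℝ} (hh : ContDiff ℝ (⊤ : ℕ∞) h) :
    ContDiff ℝ (⊤ : ℕ∞) (deriv h) := by
  have : ContDiff ℝ ((⊤ : ℕ∞) + 1) h := hh
  exact (contDiff_succ_iff_deriv.1 this).2.2

lemma exists_kernel : ∃ H K : E2 → ℝ, ContDiff ℝ (⊤ : ℕ∞) H ∧ ContDiff ℝ (⊤ : ℕ∞) K ∧
    tsupport H ⊆ closedBall 0 1 ∧ tsupport K ⊆ closedBall 0 1 ∧ (∀ y, K (-y) = K y) ∧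
    (∀ y v, fderiv ℝ (lapS H) y v = K y * ⟪y, v⟫) ∧ (∫ y, K y) ≠ 0 := by
  let f : ContDiffBump (0 : ℝ) := ⟨1/2, 1, by norm_num, by norm_num⟩
  set h : ℝ → ℝ := fun s => s * f s with hh
  have hhs : ContDiff ℝ (⊤ : ℕ∞) h := contDiff_id.mul f.contDiff
  have hhs' := contDiff_deriv_top hhs
  have hhs'' := contDiff_deriv_top hhs'
  set g : ℝ → ℝ := fun s => 4 * deriv h s + 4 * s * deriv (deriv h) s with hg
  have hgs : ContDiff ℝ (⊤ : ℕ∞) g :=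
    (contDiff_const.mul hhs').add ((contDiff_const.mul contDiff_id).mul hhs'')
  have hgs' := contDiff_deriv_top hgs
  have sh : ∀ s : ℝ, 1 < s → h =ᶠ[𝓝 s] fun _ => 0 := by
    intro s hs
    filter_upwards [lt_mem_nhds hs] with z hz
    have : f z = 0 := f.zero_of_le_dist (by
      simp [f]; exact hz.le.trans (le_abs_self z))
    simp [hh, this]
  have sh' : ∀ s : ℝ, 1 < s → deriv h s = 0 := by
    intro s hs
    rw [(sh s hs).deriv_eq]; simp
  have sg : ∀ s : ℝ, 1 < s → g s = 0 := by
    intro s hs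
    have : deriv h =ᶠ[𝓝 s] fun _ => 0 := by
      filter_upwards [lt_mem_nhds hs] with z hz using sh' z hz
    simp [hg, sh' s hs, this.deriv_eq]
  have sg' : ∀ s : ℝ, 1 < s → deriv g s = 0 := by
    intro s hs
    have : g =ᶠ[𝓝 s] fun _ => 0 := by
      filter_upwards [lt_mem_nhds hs] with z hz using sg z hz
    simp [this.deriv_eq]
  have supp : ∀ p : ℝ → ℝ, (∀ s, 1 < s → p s = 0) →
      tsupport (fun y : E2 => p (‖y‖ ^ 2)) ⊆ closedBall 0 1 := by
    intro p hp
    refine closure_minimal ?_ isClosed_closedBall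
    intro y hy
    by_contra hcon
    simp only [mem_closedBall, dist_zero_right, not_le] at hcon
    exact hy (hp _ (by nlinarith))
  have g0 : g 0 = 4 := by
    have : h =ᶠ[𝓝 0] fun s => s := by
      filter_upwards [f.eventuallyEq_one] with z hz
      simp [hh, hz]
    simp [hg, this.deriv_eq]
  have hlap : lapS (fun y : E2 => h (‖y‖ ^ 2)) = fun y => g (‖y‖ ^ 2) := by
    ext y
    rw [lapS_radial hhs]
  refine ⟨fun y => h (‖y‖ ^ 2), fun y => 2 * deriv g (‖y‖ ^ 2), hhs.comp (contDiff_norm_sq ℝ),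
    contDiff_const.mul (hgs'.comp (contDiff_norm_sq ℝ)), supp h fun s hs => (sh s hs).eq_of_nhds,
    supp (fun s => 2 * deriv g s) fun s hs => by simp [sg' s hs], fun y => by simp, ?_, ?_⟩
  · intro y v
    rw [hlap, fderiv_radial (hgs.differentiable (by simp))]
  · rw [integral_fun_norm_addHaar volume (fun r : ℝ => 2 * deriv g (r ^ 2))]
    have hder : ∀ r : ℝ, HasDerivAt (fun r : ℝ => g (r ^ 2)) (r * (2 * deriv g (r ^ 2))) r := by
      intro r
      have h1 := (hgs.differentiable (by simp) (r ^ 2)).hasDerivAt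
      have h2 := HasDerivAt.comp (h := fun x : ℝ => x ^ 2) r h1 (hasDerivAt_pow 2 r)
      refine h2.congr_deriv ?_
      simp; ring
    have hcs : HasCompactSupport (fun r : ℝ => g (r ^ 2)) := by
      refine HasCompactSupport.of_support_subset_isCompact (isCompact_closedBall (0 : ℝ) 1) ?_
      intro r hr
      by_contra hcon
      simp only [mem_closedBall, dist_zero_right, not_le, Real.norm_eq_abs] at hcon
      refine hr (sg _ ?_)
      rw [← sq_abs]; nlinarith
    have hI : ∫ r in Ioi (0 : ℝ), deriv (fun r : ℝ => g (r ^ 2)) r = - g (0 ^ 2) :=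
      hcs.integral_Ioi_deriv_eq ((hgs.comp (contDiff_id.pow 2)).of_le (by exact_mod_cast le_top)) 0
    rw [show deriv (fun r : ℝ => g (r ^ 2)) = fun r => r * (2 * deriv g (r ^ 2)) from
      funext fun r => (hder r).deriv] at hI
    have hfr : Module.finrank ℝ E2 = 2 := by simp
    rw [hfr]
    simp only [Nat.add_one_sub_one, pow_one, smul_eq_mul] at hI ⊢
    rw [hI]
    have hb : (volume : Measure E2).real (ball 0 1) ≠ 0 := by
      rw [measureReal_def]
      exact (ENNReal.toReal_pos (measure_ball_pos volume _ one_pos).ne'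
        measure_ball_lt_top.ne).ne'
    simp [g0, hb]


lemma contDiff_fderiv_top {F : Type} [NormedAddCommGroup F] [NormedSpace ℝ F] {u : E2 → F}
    (hu : ContDiff ℝ (⊤ : ℕ∞) u) : ContDiff ℝ (⊤ : ℕ∞) (fderiv ℝ u) :=
  hu.fderiv_right (by exact_mod_cast le_top)

lemma lapS_support {H : E2 → ℝ} {r : ℝ} (hH : tsupport H ⊆ closedBall 0 r) (y : E2)
    (hy : r < ‖y‖) : lapS H y = 0 := by
  have h1 : y ∉ tsupport (fderiv ℝ (fderiv ℝ H)) := fun h => by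
    have := hH (tsupport_fderiv_subset ℝ (tsupport_fderiv_subset ℝ h))
    simp only [mem_closedBall, dist_zero_right] at this
    linarith
  simp [lapS, image_eq_zero_of_notMem_tsupport h1]

lemma contDiff_lapS {H : E2 → ℝ} (hH : ContDiff ℝ (⊤ : ℕ∞) H) :
    ContDiff ℝ (⊤ : ℕ∞) (lapS H) := by
  have := contDiff_fderiv_top (contDiff_fderiv_top hH)
  unfold lapS
  fun_prop

lemma hcs_of_closedBall {F : Type} [NormedAddCommGroup F] {H : E2 → F} {r : ℝ}
    (h : ∀ y, r < ‖y‖ → H y = 0) : HasCompactSupport H := by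
  refine HasCompactSupport.of_support_subset_isCompact (isCompact_closedBall (0 : E2) r) ?_
  intro y hy
  by_contra hcon
  simp only [mem_closedBall, dist_zero_right, not_le] at hcon
  exact hy (h y hcon)

lemma mean_value {H K : E2 → ℝ} (hH : ContDiff ℝ (⊤ : ℕ∞) H) (hK : ContDiff ℝ (⊤ : ℕ∞) K)
    (sH : tsupport H ⊆ closedBall 0 1) (sK : tsupport K ⊆ closedBall 0 1)
    (hHK : ∀ y v, fderiv ℝ (lapS H) y v = K y * ⟪y, v⟫)
    {u : E2 → E2} (hu : ContDiff ℝ (⊤ : ℕ∞) u) (cu : HasCompactSupport u) (x : E2) {T : ℝ}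
    (hT : 0 < T) (hw : ∀ s, 0 < s → s < T → ∫ y, lapS H y • vLap u (x + s • y) = 0) :
    ∫ y, K y • u (x + T • y) = (∫ y, K y) • u x := by
  have hu' := contDiff_fderiv_top hu
  have hu'' := contDiff_fderiv_top hu'
  have cK : HasCompactSupport K :=
    (isCompact_closedBall (0 : E2) 1).of_isClosed_subset isClosed_closure sK
  have cG : HasCompactSupport (lapS H) := hcs_of_closedBall (r := 1) (lapS_support sH)
  have hG := contDiff_lapS hH
  have uc := hu.continuous
  have uPc := hu'.continuous
  have u''c := hu''.continuous
  have Kc := hK.continuous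
  have Gc := hG.continuous
  obtain ⟨B, hB⟩ := (cu.fderiv ℝ).exists_bound_of_continuous uPc
  have hder : ∀ s : ℝ, HasDerivAt (fun s : ℝ => ∫ y, K y • u (x + s • y))
      (∫ y, K y • fderiv ℝ u (x + s • y) y) s := by
    intro s
    refine (hasDerivAt_integral_of_dominated_loc_of_deriv_le (s := univ)
      (bound := fun y => ‖K y‖ * (B * ‖y‖)) (F' := fun s y => K y • fderiv ℝ u (x + s • y) y)
      univ_mem ?_ ?_ ?_ ?_ ?_ ?_).2
    · filter_upwards with s
      exact Continuous.aestronglyMeasurable (by fun_prop)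
    · exact Continuous.integrable_of_hasCompactSupport (by fun_prop) cK.smul_right
    · exact Continuous.aestronglyMeasurable (by fun_prop)
    · filter_upwards with y s _
      rw [norm_smul]
      gcongr
      exact (ContinuousLinearMap.le_opNorm _ _).trans (by gcongr; exact hB _)
    · exact Continuous.integrable_of_hasCompactSupport (by fun_prop) cK.norm.mul_right
    · filter_upwards with y s _
      have h1 : HasDerivAt (fun s : ℝ => x + s • y) y s := by
        simpa using ((hasDerivAt_id s).smul_const y).const_add x
      have h2 := (hu.differentiable (by simp) (x + s • y)).hasFDerivAt.comp_hasDerivAt s h1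
      exact h2.const_smul (K y)
  have hzero : ∀ s, 0 ≤ s → s < T → ∫ y, K y • fderiv ℝ u (x + s • y) y = 0 := by
    intro s hs hsT
    have e1 : ∀ y, K y • fderiv ℝ u (x + s • y) y =
        ∑ i : Fin 2, fderiv ℝ (lapS H) y (e i) • fderiv ℝ u (x + s • y) (e i) := by
      intro y
      have h1 : fderiv ℝ u (x + s • y) y = fderiv ℝ u (x + s • y) (∑ i : Fin 2, ⟪y, e i⟫ • e i) := by
        rw [sum_smul_e y]
      rw [h1, map_sum, Finset.smul_sum]
      refine Finset.sum_congr rfl fun i _ => ?_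
      rw [hHK, map_smul, smul_smul]
    have ibp : ∀ i : Fin 2, ∫ y, fderiv ℝ (lapS H) y (e i) • fderiv ℝ u (x + s • y) (e i) =
        - ∫ y, lapS H y • (s • fderiv ℝ (fderiv ℝ u) (x + s • y) (e i) (e i)) := by
      intro i
      have hgd : ∀ y, HasFDerivAt (fun y => fderiv ℝ u (x + s • y) (e i))
          (s • (fderiv ℝ (fderiv ℝ u) (x + s • y)).flip (e i)) y := by
        intro y
        have h1 : HasFDerivAt (fun y : E2 => x + s • y) (s • ContinuousLinearMap.id ℝ E2) y :=
          ((hasFDerivAt_id y).const_smul s).const_add x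
        have h2 := (hu'.differentiable (by simp) (x + s • y)).hasFDerivAt.comp y h1
        have h3 := h2.clm_apply (hasFDerivAt_const (e i) y)
        refine h3.congr_fderiv ?_
        ext v
        simp
      have hfd : ∀ y, fderiv ℝ (fun y => fderiv ℝ u (x + s • y) (e i)) y (e i) =
          s • fderiv ℝ (fderiv ℝ u) (x + s • y) (e i) (e i) := by
        intro y
        rw [(hgd y).fderiv]; simp
      have := integral_smul_fderiv_eq_neg_fderiv_smul_of_integrable (μ := (volume : Measure E2))
        (f := lapS H) (g := fun y => fderiv ℝ u (x + s • y) (e i)) (v := e i) ?_ ?_ ?_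
        (fun y _ => hG.differentiable (by simp) y) (fun y _ => (hgd y).differentiableAt)
      · simp only [hfd] at this
        rw [this, neg_neg]
      · have := (contDiff_fderiv_top hG).continuous
        exact Continuous.integrable_of_hasCompactSupport (by fun_prop)
          (cG.fderiv_apply ℝ (e i)).smul_right
      · simp only [hfd]
        exact Continuous.integrable_of_hasCompactSupport (by fun_prop) cG.smul_right
      · exact Continuous.integrable_of_hasCompactSupport (by fun_prop) cG.smul_right
    simp_rw [e1]
    rw [integral_finsetSum]
    · simp_rw [ibp]
      rw [Finset.sum_neg_distrib, ← integral_finsetSum]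
      · have : ∀ y, ∑ i : Fin 2, lapS H y • (s • fderiv ℝ (fderiv ℝ u) (x + s • y) (e i) (e i)) =
            s • (lapS H y • vLap u (x + s • y)) := by
          intro y
          rw [vLap, Finset.smul_sum, Finset.smul_sum]
          refine Finset.sum_congr rfl fun i _ => ?_
          rw [smul_comm]
        simp_rw [this]
        rw [integral_smul]
        rcases hs.eq_or_lt with h0 | h0
        · simp [← h0]
        · rw [hw s h0 hsT]; simp
      · intro i _
        exact Continuous.integrable_of_hasCompactSupport (by fun_prop) cG.smul_right
    · intro i _
      have := (contDiff_fderiv_top hG).continuous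
      exact Continuous.integrable_of_hasCompactSupport (by fun_prop)
        (cG.fderiv_apply ℝ (e i)).smul_right
  have hcont : ContinuousOn (fun s : ℝ => ∫ y, K y • u (x + s • y)) (Icc 0 T) :=
    fun s _ => (hder s).continuousAt.continuousWithinAt
  have hfin := constant_of_has_deriv_right_zero hcont (fun s hs => by
    have := (hder s).hasDerivWithinAt (s := Ici s)
    rwa [hzero s hs.1 hs.2] at this) T (right_mem_Icc.2 hT.le)
  simp only [zero_smul, add_zero] at hfin
  rw [hfin, integral_smul_const]

lemma weak_to_local {H : E2 → ℝ} (hH : ContDiff ℝ (⊤ : ℕ∞) H) (sH : tsupport H ⊆ closedBall 0 1)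
    {Ω : Set E2} {X u : E2 → E2} (hu : ContDiff ℝ (⊤ : ℕ∞) u)
    (hX : ∀ φ : E2 → E2, ContDiff ℝ (⊤ : ℕ∞) φ → HasCompactSupport φ → tsupport φ ⊆ Ω →
          (∫ x in Ω, ⟪vLap X x, vLap φ x⟫) = 0)
    {z : E2} {s : ℝ} (hs : 0 < s) (hz : closedBall z s ⊆ Ω)
    (hXu : ∀ w ∈ closedBall z s, X =ᶠ[𝓝 w] u) :
    ∫ y, lapS H y • vLap u (z + s • y) = 0 := by
  have hs0 : s ≠ 0 := hs.ne'
  have hG := contDiff_lapS hH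
  have cG : HasCompactSupport (lapS H) := hcs_of_closedBall (r := 1) (lapS_support sH)
  have uc : Continuous (vLap u) := by
    have := (contDiff_fderiv_top (contDiff_fderiv_top hu)).continuous
    unfold vLap
    fun_prop
  have Gc := hG.continuous
  refine ext_inner_left ℝ fun v => ?_
  have hintg : Integrable (fun y => lapS H y • vLap u (z + s • y)) :=
    Continuous.integrable_of_hasCompactSupport (by fun_prop) cG.smul_right
  rw [inner_zero_right, ← integral_inner hintg]
  set η : E2 → ℝ := fun w => H (s⁻¹ • (w - z)) with hη
  have hsc : ContDiff ℝ (⊤ : ℕ∞) (fun w : E2 => s⁻¹ • (w - z)) := by fun_prop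
  have hηs : ContDiff ℝ (⊤ : ℕ∞) η := hH.comp hsc
  have hη1 : fderiv ℝ η = fun w => s⁻¹ • fderiv ℝ H (s⁻¹ • (w - z)) := by
    ext1 w
    rw [hη, fderiv_comp_sub (f := fun w => H (s⁻¹ • w)), fderiv_comp_smul]
  have hη2 : ∀ w, fderiv ℝ (fderiv ℝ η) w = (s⁻¹ * s⁻¹) • fderiv ℝ (fderiv ℝ H) (s⁻¹ • (w - z)) := by
    intro w
    have hd : DifferentiableAt ℝ (fun w => fderiv ℝ H (s⁻¹ • (w - z))) w := by
      have := (contDiff_fderiv_top hH).comp hsc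
      exact this.differentiable (by simp) w
    rw [hη1, fderiv_fun_const_smul hd,
      fderiv_comp_sub (f := fun w => fderiv ℝ H (s⁻¹ • w)), fderiv_comp_smul, smul_smul]
  have hφ1 : fderiv ℝ (fun w => η w • v) = fun w => (fderiv ℝ η w).smulRight v := by
    ext1 w
    rw [fderiv_smul_const (hηs.differentiable (by simp) w)]
  have hφ2 : ∀ w a b, fderiv ℝ (fderiv ℝ (fun w => η w • v)) w a b =
      fderiv ℝ (fderiv ℝ η) w a b • v := by
    intro w a b
    have h1 : fderiv ℝ (fun w => η w • v) =
        fun w => (ContinuousLinearMap.smulRightL ℝ E2 E2).flip v (fderiv ℝ η w) := hφ1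
    rw [h1]
    have := ((ContinuousLinearMap.smulRightL ℝ E2 E2).flip v).hasFDerivAt.comp w
      ((contDiff_fderiv_top hηs).differentiable (by simp) w).hasFDerivAt
    have h2 := this.fderiv
    simp only [Function.comp_def] at h2
    rw [h2]
    simp
  have hφ : ∀ w, vLap (fun w => η w • v) w = (s⁻¹ * s⁻¹ * lapS H (s⁻¹ • (w - z))) • v := by
    intro w
    unfold vLap lapS
    simp_rw [hφ2, hη2]
    rw [← Finset.sum_smul, Finset.mul_sum]
    simp
  have sη : ∀ w, w ∉ closedBall z s → 1 < ‖s⁻¹ • (w - z)‖ := by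
    intro w hw
    rw [norm_smul, norm_inv, Real.norm_of_nonneg hs.le, ← dist_eq_norm]
    simp only [mem_closedBall, not_le] at hw
    rw [inv_mul_eq_div, one_lt_div hs]; exact hw
  have hts : tsupport (fun w => η w • v) ⊆ closedBall z s := by
    refine closure_minimal ?_ isClosed_closedBall
    intro w hw
    by_contra hcon
    have h1 := sη w hcon
    refine hw ?_
    have : H (s⁻¹ • (w - z)) = 0 := image_eq_zero_of_notMem_tsupport fun h => by
      have := sH h
      simp only [mem_closedBall, dist_zero_right] at this
      linarith
    simp [hη, this]
  have key := hX (fun w => η w • v) (hηs.smul contDiff_const)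
    ((isCompact_closedBall z s).of_isClosed_subset isClosed_closure hts) (hts.trans hz)
  have h0 : ∀ w, w ∉ closedBall z s → lapS H (s⁻¹ • (w - z)) = 0 := fun w hw =>
    lapS_support sH _ (sη w hw)
  rw [setIntegral_eq_integral_of_forall_compl_eq_zero] at key
  swap
  · intro w hw
    rw [hφ, h0 w fun h => hw (hz h)]; simp
  have hpt : ∀ w, ⟪vLap X w, vLap (fun w => η w • v) w⟫ =
      s⁻¹ * s⁻¹ * ⟪v, lapS H (s⁻¹ • (w - z)) • vLap u w⟫ := by
    intro w
    rw [hφ]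
    by_cases hw : w ∈ closedBall z s
    · have h1 := hXu w hw
      have h2 : fderiv ℝ (fderiv ℝ X) w = fderiv ℝ (fderiv ℝ u) w := h1.fderiv.fderiv_eq
      have : vLap X w = vLap u w := by simp [vLap, h2]
      rw [this, inner_smul_right, inner_smul_right, real_inner_comm]; ring
    · simp [h0 w hw]
  simp_rw [hpt] at key
  rw [integral_const_mul] at key
  have key2 := (mul_eq_zero.1 key).resolve_left (by positivity)
  rw [← integral_add_left_eq_self _ z] at key2
  have key3 := Measure.integral_comp_smul (volume : Measure E2)
    (fun w => ⟪v, lapS H (s⁻¹ • (z + w - z)) • vLap u (z + w)⟫) s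
  rw [key2] at key3
  simpa [smul_smul, hs0] using key3


lemma three_le : (3 : WithTop ℕ∞) ≤ ((⊤ : ℕ∞) : WithTop ℕ∞) :=
  WithTop.coe_le_coe.2 (le_top : (3 : ℕ∞) ≤ ⊤)

lemma sq_integral_le {S : Set E2} (hS : (volume S) ≠ ∞) (hS0 : 0 < volume.real S)
    {f : E2 → ℝ} (hf : IntegrableOn f S) (hf2 : IntegrableOn (fun x => f x ^ 2) S) :
    (∫ x in S, f x) ^ 2 ≤ volume.real S * ∫ x in S, f x ^ 2 := by
  set V := volume.real S with hV
  set I := ∫ x in S, f x with hI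
  have h0 : 0 ≤ ∫ x in S, (f x - I / V) ^ 2 := integral_nonneg fun x => sq_nonneg _
  have hc : IntegrableOn (fun _ : E2 => (I / V) ^ 2) S := integrableOn_const hS
  have h1 : ∫ x in S, (f x - I / V) ^ 2 =
      (∫ x in S, f x ^ 2) - 2 * (I / V) * I + V * (I / V) ^ 2 := by
    have : ∀ x, (f x - I / V) ^ 2 = f x ^ 2 - 2 * (I / V) * f x + (I / V) ^ 2 := fun x => by ring
    simp_rw [this]
    have hcm : IntegrableOn (fun x => 2 * (I / V) * f x) S := hf.const_mul _
    have hsub : IntegrableOn (fun x => f x ^ 2 - 2 * (I / V) * f x) S := hf2.sub hcm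
    rw [integral_add hsub hc, integral_sub hf2 hcm,
      integral_const_mul, setIntegral_const, smul_eq_mul]
  rw [h1] at h0
  have h2 : V * ((∫ x in S, f x ^ 2) - 2 * (I / V) * I + V * (I / V) ^ 2) =
      V * (∫ x in S, f x ^ 2) - I ^ 2 := by
    field_simp
    ring
  have := mul_nonneg hS0.le h0
  linarith

lemma pointwise_estimate : ∃ A : ℝ, 0 ≤ A ∧ ∀ Ω : Set E2, IsOpen Ω →
    ∀ X : E2 → E2, ContDiffOn ℝ (⊤ : ℕ∞) X Ω →
    (∀ φ : E2 → E2, ContDiff ℝ (⊤ : ℕ∞) φ → HasCompactSupport φ → tsupport φ ⊆ Ω →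
          (∫ x in Ω, ⟪vLap X x, vLap φ x⟫) = 0) →
    ∀ (x : E2) (t : ℝ), 0 < t → closedBall x (2 * t) ⊆ Ω →
      ‖iteratedFDeriv ℝ 3 X x‖ ^ 2 ≤ A * (t ^ 8)⁻¹ * ∫ y in closedBall x t, ‖X y‖ ^ 2 := by
  obtain ⟨H, K, hH, hK, sH, sK, hKe, hHK, hc⟩ := exists_kernel
  set c := ∫ y, K y with hcdef
  have cK : HasCompactSupport K :=
    (isCompact_closedBall (0 : E2) 1).of_isClosed_subset isClosed_closure sK
  obtain ⟨M, hM⟩ := (cK.iteratedFDeriv (𝕜 := ℝ) 3).exists_bound_of_continuous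
    (hK.continuous_iteratedFDeriv (m := 3) three_le)
  have hM0 : 0 ≤ M := (norm_nonneg _).trans (hM 0)
  set L : E2 →L[ℝ] ℝ →L[ℝ] E2 := (ContinuousLinearMap.lsmul ℝ ℝ).flip with hL
  set v := (volume : Measure E2).real (ball 0 1) with hv
  have hv0 : 0 < v := by
    rw [hv, measureReal_def]
    exact ENNReal.toReal_pos (measure_ball_pos volume _ one_pos).ne' measure_ball_lt_top.ne
  refine ⟨(|c|⁻¹ * ‖L‖ * M) ^ 2 * v, by positivity, ?_⟩
  intro Ω hΩ X hX hweak x t ht hball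
  have ht0 : t ≠ 0 := ht.ne'
  let χ : ContDiffBump x := ⟨7 / 4 * t, 2 * t, by positivity, by linarith⟩
  set u : E2 → E2 := fun w => χ w • X w with hudef
  have hsu : tsupport u ⊆ closedBall x (2 * t) := by
    have h1 : tsupport u ⊆ tsupport χ := tsupport_smul_subset_left χ X
    rwa [χ.tsupport_eq] at h1
  have hu : ContDiff ℝ (⊤ : ℕ∞) u := by
    rw [contDiff_iff_contDiffAt]
    intro w
    by_cases hw : w ∈ Ω
    · exact χ.contDiffAt.smul (hX.contDiffAt (hΩ.mem_nhds hw))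
    · have : u =ᶠ[𝓝 w] fun _ => 0 := notMem_tsupport_iff_eventuallyEq.1 fun h => hw (hball (hsu h))
      exact contDiffAt_const.congr_of_eventuallyEq this
  have cu : HasCompactSupport u :=
    (isCompact_closedBall x (2 * t)).of_isClosed_subset isClosed_closure hsu
  have hXu : ∀ w ∈ ball x (7 / 4 * t), X =ᶠ[𝓝 w] u := by
    intro w hw
    filter_upwards [χ.eventuallyEq_one_of_mem_ball hw] with a ha
    simp [hudef, ha]
  set κ : E2 → ℝ := fun w => K (t⁻¹ • w) with hκ
  have hκs : ContDiff ℝ (⊤ : ℕ∞) κ := hK.comp (contDiff_const_smul t⁻¹)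
  have cκ : HasCompactSupport κ := cK.comp_smul (inv_ne_zero ht0)
  have hrep : ∀ z ∈ ball x (t / 2), X z = (c * t ^ 2)⁻¹ • convolution u κ L volume z := by
    intro z hz
    have hsub : ∀ s, s ≤ t → closedBall z s ⊆ ball x (7 / 4 * t) := by
      intro s hs w hw
      rw [mem_closedBall] at hw
      rw [mem_ball] at hz ⊢
      have := dist_triangle w z x
      linarith
    have hsubΩ : ball x (7 / 4 * t) ⊆ Ω :=
      (ball_subset_closedBall.trans (closedBall_subset_closedBall (by linarith))).trans hball
    have hmv := mean_value hH hK sH sK hHK hu cu z ht fun s hs hst =>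
      weak_to_local hH sH hu hweak hs ((hsub s hst.le).trans hsubΩ)
        fun w hw => hXu w (hsub s hst.le hw)
    have hXz : X z = u z := (hXu z (hsub 0 ht.le (by simp))).eq_of_nhds
    have hconv : convolution u κ L volume z = t ^ 2 • ∫ y, K y • u (z + t • y) := by
      have h1 := Measure.integral_comp_smul_of_nonneg (volume : Measure E2)
        (fun w => κ w • u (z + w)) t (hR := ht.le)
      have h2 : ∀ y, κ (t • y) = K y := fun y => by simp [hκ, smul_smul, ht0]
      simp only [h2] at h1
      rw [h1]
      have hfr : Module.finrank ℝ E2 = 2 := by simp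
      rw [hfr, smul_smul, mul_inv_cancel₀ (by positivity), one_smul, convolution]
      rw [← integral_add_left_eq_self _ z]
      refine integral_congr_ae (Eventually.of_forall fun w => ?_)
      simp [hL, hκ, hKe]
    rw [hconv, hmv, hXz, smul_smul, smul_smul]
    rw [← hcdef, show (c * t ^ 2)⁻¹ * t ^ 2 * c = 1 by field_simp, one_smul]
  have hconvS : ContDiff ℝ (⊤ : ℕ∞) (convolution u κ L volume) :=
    cκ.contDiff_convolution_right L hu.continuous.locallyIntegrable hκs
  have hit : iteratedFDeriv ℝ 3 X x =
      (c * t ^ 2)⁻¹ • iteratedFDeriv ℝ 3 (convolution u κ L volume) x := by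
    have h1 : X =ᶠ[𝓝 x] (c * t ^ 2)⁻¹ • convolution u κ L volume := by
      filter_upwards [ball_mem_nhds x (half_pos ht)] with z hz using hrep z hz
    rw [(h1.iteratedFDeriv ℝ 3).eq_of_nhds, iteratedFDeriv_const_smul_apply]
    exact (hconvS.of_le three_le).contDiffAt
  have hb := conv_bound 3 u hu.continuous L κ hκs cκ x
  have hκ3 : ∀ w, ‖iteratedFDeriv ℝ 3 κ w‖ ≤ (closedBall (0 : E2) t).indicator (fun _ => (t ^ 3)⁻¹ * M) w := by
    intro w
    have h1 : iteratedFDeriv ℝ 3 κ w = (t⁻¹) ^ 3 • iteratedFDeriv ℝ 3 K (t⁻¹ • w) := by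
      rw [hκ, iteratedFDeriv_comp_const_smul t⁻¹ (hK.of_le three_le)]
    by_cases hw : w ∈ closedBall (0 : E2) t
    · rw [indicator_of_mem hw, h1, norm_smul, norm_pow, norm_inv, Real.norm_of_nonneg ht.le, inv_pow]
      gcongr
      exact hM _
    · rw [indicator_of_notMem hw, h1]
      have : iteratedFDeriv ℝ 3 K (t⁻¹ • w) = 0 := by
        refine image_eq_zero_of_notMem_tsupport fun h => hw ?_
        have := sK (tsupport_iteratedFDeriv_subset 3 h)
        simp only [mem_closedBall, dist_zero_right, norm_smul, norm_inv,
          Real.norm_of_nonneg ht.le] at this ⊢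
        rwa [inv_mul_le_iff₀ ht, mul_one] at this
      simp [this]
  have hcb : closedBall x t ⊆ ball x (7 / 4 * t) := closedBall_subset_ball (by linarith)
  have hXc : ContinuousOn X (closedBall x t) := hX.continuousOn.mono
    ((closedBall_subset_closedBall (by linarith)).trans hball)
  have hXi : IntegrableOn (fun y => ‖X y‖) (closedBall x t) :=
    hXc.norm.integrableOn_compact (isCompact_closedBall x t)
  have hXi2 : IntegrableOn (fun y => ‖X y‖ ^ 2) (closedBall x t) :=
    (hXc.norm.pow 2).integrableOn_compact (isCompact_closedBall x t)
  have hintg : ∫ w, ‖u w‖ * ‖iteratedFDeriv ℝ 3 κ (x - w)‖ ≤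
      (t ^ 3)⁻¹ * M * ∫ w in closedBall x t, ‖X w‖ := by
    rw [← integral_const_mul, ← integral_indicator measurableSet_closedBall]
    refine integral_mono_of_nonneg (Eventually.of_forall fun w => by positivity)
      ((integrable_indicator_iff measurableSet_closedBall).2 (hXi.const_mul _))
      (Eventually.of_forall fun w => ?_)
    have h1 := hκ3 (x - w)
    by_cases hw : w ∈ closedBall x t
    · have hw' : x - w ∈ closedBall (0 : E2) t := by
        simpa [mem_closedBall, dist_eq_norm, norm_sub_rev] using hw
      rw [indicator_of_mem hw'] at h1
      simp only [indicator_of_mem hw]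
      rw [← (hXu w (hcb hw)).eq_of_nhds, mul_comm]
      gcongr
    · have hw' : x - w ∉ closedBall (0 : E2) t := by
        simpa [mem_closedBall, dist_eq_norm, norm_sub_rev] using hw
      rw [indicator_of_notMem hw'] at h1
      simp only [indicator_of_notMem hw]
      rw [le_antisymm h1 (norm_nonneg _), mul_zero]
  have hvol : (volume : Measure E2).real (closedBall x t) = t ^ 2 * v := by
    have := Measure.addHaar_real_closedBall (volume : Measure E2) x ht.le
    simpa using this
  have hcs := sq_integral_le (S := closedBall x t) measure_closedBall_lt_top.ne
    (by rw [hvol]; positivity) hXi hXi2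
  rw [hvol] at hcs
  set J := ∫ w in closedBall x t, ‖X w‖ with hJ
  have hfin : ‖iteratedFDeriv ℝ 3 X x‖ ≤ |c|⁻¹ * ‖L‖ * M * (t ^ 5)⁻¹ * J := by
    rw [hit, norm_smul, norm_inv, norm_mul, norm_pow, Real.norm_of_nonneg ht.le, Real.norm_eq_abs]
    calc (|c| * t ^ 2)⁻¹ * ‖iteratedFDeriv ℝ 3 (convolution u κ L volume) x‖
        ≤ (|c| * t ^ 2)⁻¹ * (‖L‖ * ((t ^ 3)⁻¹ * M * J)) := by
          gcongr
          exact hb.trans (by gcongr)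
      _ = _ := by
          have : |c| ≠ 0 := abs_ne_zero.2 hc
          field_simp
  calc ‖iteratedFDeriv ℝ 3 X x‖ ^ 2 ≤ (|c|⁻¹ * ‖L‖ * M * (t ^ 5)⁻¹ * J) ^ 2 := by gcongr
    _ = (|c|⁻¹ * ‖L‖ * M * (t ^ 5)⁻¹) ^ 2 * J ^ 2 := by ring
    _ ≤ (|c|⁻¹ * ‖L‖ * M * (t ^ 5)⁻¹) ^ 2 * (t ^ 2 * v * ∫ y in closedBall x t, ‖X y‖ ^ 2) := by
        gcongr
    _ = _ := by field_simp

lemma closedBall_subset_of_sdist {Ω : Set E2} (hΩ : IsOpen Ω) {ρ : ℝ} (hρ : 0 < ρ) {x : E2}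
    (hx : sdist Ω x < -ρ) : x ∈ Ω ∧ closedBall x ρ ⊆ Ω ∧ ρ < infDist x (frontier Ω) := by
  unfold sdist at hx
  split_ifs at hx with hxΩ
  · have hlt : ρ < infDist x (frontier Ω) := by linarith
    refine ⟨hxΩ, ?_, hlt⟩
    have hdis : Disjoint (closedBall x ρ) (frontier Ω) := by
      rw [Set.disjoint_left]
      intro w hw hwf
      have := infDist_le_dist_of_mem (x := x) hwf
      rw [mem_closedBall, dist_comm] at hw
      linarith
    by_contra hcon
    obtain ⟨w, hw, hw'⟩ := Set.not_subset.1 hcon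
    have hpc : IsPreconnected (closedBall x ρ) := (convex_closedBall x ρ).isPreconnected
    have hcl : ∀ a ∈ closedBall x ρ, a ∉ Ω → a ∈ (closure Ω)ᶜ := by
      intro a ha haΩ hac
      exact Set.disjoint_left.1 hdis ha ⟨hac, by rwa [hΩ.interior_eq]⟩
    obtain ⟨a, -, ha, ha'⟩ := hpc Ω (closure Ω)ᶜ hΩ isClosed_closure.isOpen_compl
      (fun a ha => by
        by_cases h : a ∈ Ω
        · exact Or.inl h
        · exact Or.inr (hcl a ha h))
      ⟨x, mem_closedBall_self hρ.le, hxΩ⟩ ⟨w, hw, hcl w hw hw'⟩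
    exact ha' (subset_closure ha)
  · have := infDist_nonneg (x := x) (s := Ω)
    linarith


/-- Lemma 2.8, interior regularity estimate: for a weakly biharmonic
field `X ∈ H²(Ω;ℝ²)` (hence smooth inside `Ω`), on the sublevel set `{d_Ω < -ρ}` one has
`∫ |∇³X|² ≤ C ∫_Ω (ρ⁻²|∇²X|² + ρ⁻⁴|∇X|² + ρ⁻⁶|X|²)` with an independent constant. -/
theorem interior_regularity_estimate :
    ∃ C : ℝ, ∀ Ω : Set E2, IsOpen Ω → IsConnected Ω →
      ∀ ρ : ℝ, 0 < ρ → ({x : E2 | sdist Ω x < -ρ}).Nonempty →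
      ∀ X : E2 → E2, ContDiffOn ℝ (⊤ : ℕ∞) X Ω →
        IntegrableOn (fun x => ‖X x‖^2) Ω →
        IntegrableOn (fun x => ‖iteratedFDeriv ℝ 1 X x‖^2) Ω →
        IntegrableOn (fun x => ‖iteratedFDeriv ℝ 2 X x‖^2) Ω →
        (∀ φ : E2 → E2, ContDiff ℝ (⊤ : ℕ∞) φ → HasCompactSupport φ → tsupport φ ⊆ Ω →
          (∫ x in Ω, ⟪vLap X x, vLap φ x⟫) = 0) →
        (∫ x in {x : E2 | sdist Ω x < -ρ}, ‖iteratedFDeriv ℝ 3 X x‖^2) ≤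
          C * ∫ x in Ω, ((ρ^2)⁻¹ * ‖iteratedFDeriv ℝ 2 X x‖^2 +
            (ρ^4)⁻¹ * ‖iteratedFDeriv ℝ 1 X x‖^2 + (ρ^6)⁻¹ * ‖X x‖^2) := by
  obtain ⟨A, hA, hpt⟩ := pointwise_estimate
  set v := (volume : Measure E2).real (ball 0 1) with hv
  have hv0 : 0 ≤ v := measureReal_nonneg
  refine ⟨64 * A * v, ?_⟩
  intro Ω hΩ _ ρ hρ _ X hX h0 h1 h2 hweak
  set t := ρ / 2 with ht
  have ht0 : 0 < t := by positivity
  set D := {x : E2 | sdist Ω x < -ρ} with hD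
  have hDm : MeasurableSet D := by
    have : D = Ω ∩ {x | ρ < infDist x (frontier Ω)} := by
      ext x
      constructor
      · intro hx
        obtain ⟨a, _, b⟩ := closedBall_subset_of_sdist hΩ hρ hx
        exact ⟨a, b⟩
      · rintro ⟨a, b⟩
        simp only [hD, Set.mem_ofPred_eq, sdist, if_pos a] at b ⊢
        linarith
    rw [this]
    exact (hΩ.inter (isOpen_lt continuous_const (continuous_infDist_pt _))).measurableSet
  set f : E2 → ℝ := Ω.indicator fun y => ‖X y‖ ^ 2 with hf
  set k : E2 → ℝ := (closedBall (0 : E2) t).indicator fun _ => 1 with hk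
  have hfi : Integrable f := (integrable_indicator_iff hΩ.measurableSet).2 h0
  have hki : Integrable k := (integrable_indicator_iff measurableSet_closedBall).2
    (integrableOn_const measure_closedBall_lt_top.ne)
  have hf0 : ∀ y, 0 ≤ f y := fun y => indicator_nonneg (fun _ _ => by positivity) y
  have hk0 : ∀ y, 0 ≤ k y := fun y => indicator_nonneg (fun _ _ => by positivity) y
  set Q : E2 → ℝ := convolution f k (ContinuousLinearMap.mul ℝ ℝ) volume with hQ
  have hQi : Integrable Q := hfi.integrable_convolution _ hki
  have hQ0 : ∀ x, 0 ≤ Q x := fun x => integral_nonneg fun y => mul_nonneg (hf0 y) (hk0 _)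
  have hkint : ∫ y, k y = t ^ 2 * v := by
    rw [hk, integral_indicator measurableSet_closedBall, setIntegral_const, smul_eq_mul, mul_one]
    have := Measure.addHaar_real_closedBall (volume : Measure E2) 0 ht0.le
    simpa using this
  have hQint : ∫ x, Q x = (∫ y in Ω, ‖X y‖ ^ 2) * (t ^ 2 * v) := by
    rw [hQ, integral_convolution _ hfi hki, hkint, hf, integral_indicator hΩ.measurableSet]
    rfl
  have hQx : ∀ x ∈ D, ∫ y in closedBall x t, ‖X y‖ ^ 2 = Q x := by
    intro x hx
    obtain ⟨_, hb, _⟩ := closedBall_subset_of_sdist hΩ hρ hx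
    rw [← integral_indicator measurableSet_closedBall, hQ, convolution]
    refine integral_congr_ae (Eventually.of_forall fun y => ?_)
    simp only [ContinuousLinearMap.mul_apply']
    by_cases hy : y ∈ closedBall x t
    · have hy' : x - y ∈ closedBall (0 : E2) t := by
        simpa [mem_closedBall, dist_eq_norm, norm_sub_rev] using hy
      have hyΩ : y ∈ Ω := hb (closedBall_subset_closedBall (by linarith) hy)
      simp [hf, hk, indicator_of_mem hy, indicator_of_mem hy', indicator_of_mem hyΩ]
    · have hy' : x - y ∉ closedBall (0 : E2) t := by
        simpa [mem_closedBall, dist_eq_norm, norm_sub_rev] using hy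
      simp only [hk, indicator_of_notMem hy, indicator_of_notMem hy', mul_zero]
  have step1 : (∫ x in D, ‖iteratedFDeriv ℝ 3 X x‖ ^ 2) ≤ ∫ x in D, A * (t ^ 8)⁻¹ * Q x := by
    refine integral_mono_of_nonneg (Eventually.of_forall fun x => by positivity)
      (hQi.const_mul _).integrableOn ?_
    refine (ae_restrict_iff' hDm).2 (Eventually.of_forall fun x hx => ?_)
    obtain ⟨_, hb, _⟩ := closedBall_subset_of_sdist hΩ hρ hx
    have := hpt Ω hΩ X hX hweak x t ht0 (by rwa [ht, mul_div_cancel₀ _ two_ne_zero])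
    rwa [hQx x hx] at this
  have step2 : ∫ x in D, A * (t ^ 8)⁻¹ * Q x ≤ ∫ x, A * (t ^ 8)⁻¹ * Q x :=
    setIntegral_le_integral (hQi.const_mul _)
      (Eventually.of_forall fun x => mul_nonneg (by positivity) (hQ0 x))
  have step3 : ∫ x in Ω, (ρ^6)⁻¹ * ‖X x‖^2 ≤ ∫ x in Ω, ((ρ^2)⁻¹ * ‖iteratedFDeriv ℝ 2 X x‖^2 +
            (ρ^4)⁻¹ * ‖iteratedFDeriv ℝ 1 X x‖^2 + (ρ^6)⁻¹ * ‖X x‖^2) := by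
    refine integral_mono (h0.const_mul _)
      (((h2.const_mul _).add (h1.const_mul _)).add (h0.const_mul _)) fun x => ?_
    have : 0 ≤ (ρ^2)⁻¹ * ‖iteratedFDeriv ℝ 2 X x‖^2 + (ρ^4)⁻¹ * ‖iteratedFDeriv ℝ 1 X x‖^2 := by
      positivity
    simp only
    linarith
  refine (step1.trans step2).trans (le_trans (le_of_eq ?_)
    (mul_le_mul_of_nonneg_left step3 (by positivity)))
  rw [integral_const_mul, integral_const_mul, hQint, ht]
  field_simp
  ring

end StokesPaper

end
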